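/- arXiv:1709.07073 — 2 statements merged into one kernel-verified Lean document; each statement's English description precedes it below -/
import Mathlib

section
/- Suppose that whenever Ω* ∩ argmin_{x∈A} F(x,λ*,c) ≠ ∅ for some λ* ∈ Λ and c > 0, the function F is globally parametrically exact with exact tuning parameter λ*. Suppose also that Ω is closed and f is lower semicontinuous on Ω. Then F is globally parametrically exact if and only if there exists λ* ∈ Λ such that: (1) F is of penalty-type and non-degenerate for λ = λ*; and (2) F is locally parametrically exact with exact tuning parameter λ* at every globally optimal solution of the problem (P). -/
open Set Filter Topology

/-- The set of global minimizers of `g` on the set `A`. -/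
def minimizersOn {X : Type*} (g : X → EReal) (A : Set X) : Set X :=
  {x ∈ A | ∀ y ∈ A, g x ≤ g y}

/-- The set of globally optimal solutions of the problem (P):
minimize `f x` subject to `x ∈ M`, `x ∈ A`. -/
def optSet {X : Type*} (f : X → EReal) (M A : Set X) : Set X :=
  minimizersOn f (M ∩ A)

/-- `F` is globally parametrically exact with exact tuning parameter `lam`. -/
def GloballyParamExact {X Λ : Type*} (f : X → EReal) (M A : Set X)
    (F : X → Λ → ℝ → EReal) (lam : Λ) : Prop :=
  ∃ cs > (0 : ℝ), ∀ c ≥ cs, minimizersOn (fun x => F x lam c) A = optSet f M A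

/-- `F` is locally parametrically exact at `x₀` with exact tuning parameter `lam`. -/
def LocallyParamExact {X Λ : Type*} [TopologicalSpace X] (A : Set X)
    (F : X → Λ → ℝ → EReal) (lam : Λ) (x₀ : X) : Prop :=
  ∃ cs > (0 : ℝ), ∃ U ∈ 𝓝 x₀, ∀ c ≥ cs, ∀ x ∈ U ∩ A, F x₀ lam c ≤ F x lam c

/-- `F` is a penalty-type separating function for `λ = lam`. -/
def PenaltyType {X Λ : Type*} [TopologicalSpace X] (f : X → EReal) (M A : Set X)
    (F : X → Λ → ℝ → EReal) (lam : Λ) : Prop :=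
  ∃ c₀ > (0 : ℝ), ∀ cseq : ℕ → ℝ, StrictMono cseq → (∀ n, c₀ ≤ cseq n) →
    Tendsto cseq atTop atTop →
    ∀ xseq : ℕ → X, (∀ n, xseq n ∈ minimizersOn (fun x => F x lam (cseq n)) A) →
    ∀ x₀ : X, MapClusterPt x₀ atTop xseq → x₀ ∈ optSet f M A

/-- `F` is non-degenerate for `λ = lam`. -/
def NonDegenerate {X Λ : Type*} [NormedAddCommGroup X] (A : Set X)
    (F : X → Λ → ℝ → EReal) (lam : Λ) : Prop :=
  ∃ c₀ > (0 : ℝ), ∃ R > (0 : ℝ), ∀ c ≥ c₀,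
    ∃ x ∈ minimizersOn (fun y => F y lam c) A, ‖x‖ ≤ R

theorem isClosed_minimizersOn {X : Type*} [TopologicalSpace X] {g : X → EReal} {A : Set X}
    (hA : IsClosed A) (hg : LowerSemicontinuousOn g A) : IsClosed (minimizersOn g A) := by
  refine isClosed_of_closure_subset fun x hx => ?_
  have hxA : x ∈ A := hA.closure_subset_iff.2 (fun _ h => h.1) hx
  refine ⟨hxA, fun y hy => ?_⟩
  by_contra! hlt
  obtain ⟨z, hz, hyz⟩ := ((mem_closure_iff_frequently.1 hx).and_eventually
    (eventually_nhdsWithin_iff.1 (hg x hxA (g y) hlt))).exists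
  exact absurd (hz.2 y hy) (not_le.2 (hyz hz.1))

/-- Localization Principle in the Parametric Form I. -/
theorem localization_principle_parametric_I
    {X : Type*} [NormedAddCommGroup X] [NormedSpace ℝ X] [FiniteDimensional ℝ X]
    {Λ : Type*} [Nonempty Λ]
    (f : X → EReal) (M A : Set X) (F : X → Λ → ℝ → EReal)
    (hM : M.Nonempty) (hA : A.Nonempty)
    (hfeas : ∃ x ∈ M ∩ A, f x < ⊤)
    (hopt : (optSet f M A).Nonempty)
    (hkey : ∀ lam : Λ, ∀ c > (0 : ℝ),
      (optSet f M A ∩ minimizersOn (fun x => F x lam c) A).Nonempty →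
      GloballyParamExact f M A F lam)
    (hΩ : IsClosed (M ∩ A))
    (hf : LowerSemicontinuousOn f (M ∩ A)) :
    (∃ lam : Λ, GloballyParamExact f M A F lam) ↔
      ∃ lam : Λ,
        (PenaltyType f M A F lam ∧ NonDegenerate A F lam) ∧
        (∀ x₀ ∈ optSet f M A, LocallyParamExact A F lam x₀) := by
  constructor
  · rintro ⟨lam, cs, hcs, hex⟩
    refine ⟨lam, ⟨⟨cs, hcs, ?_⟩, ?_⟩, ?_⟩
    · intro cseq _ hge _ xseq hx x₀ hx₀
      have hcl : x₀ ∈ closure (optSet f M A) := by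
        refine mem_closure_iff_nhds.2 fun U hU => ?_
        obtain ⟨n, hn⟩ := (hx₀.frequently hU).exists
        exact ⟨xseq n, hn, hex _ (hge n) ▸ hx n⟩
      exact (isClosed_minimizersOn hΩ hf).closure_subset hcl
    · obtain ⟨x, hx⟩ := hopt
      exact ⟨cs, hcs, ‖x‖ + 1, by positivity, fun c hc => ⟨x, (hex c hc).symm ▸ hx, by simp⟩⟩
    · intro x₀ hx₀
      refine ⟨cs, hcs, univ, univ_mem, fun c hc x hx => ?_⟩
      rw [← hex c hc] at hx₀
      exact hx₀.2 x hx.2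
  · rintro ⟨lam, ⟨⟨c₁, hc₁, hpen⟩, c₂, -, R, -, hnd⟩, hloc⟩
    have hmax : ∀ n : ℕ, max c₁ c₂ ≤ max c₁ c₂ + n := fun n => by simp
    choose xseq hxmin hxR using fun n : ℕ =>
      hnd (max c₁ c₂ + n) ((le_max_right _ _).trans (hmax n))
    have htend : Tendsto (fun n : ℕ => max c₁ c₂ + (n : ℝ)) atTop atTop :=
      tendsto_atTop_add_const_left _ _ tendsto_natCast_atTop_atTop
    have : ProperSpace X := FiniteDimensional.proper ℝ X
    obtain ⟨x₀, -, hx₀⟩ := (isCompact_closedBall (0 : X) R).exists_mapClusterPt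
      (f := atTop) (u := xseq) (tendsto_principal.2 (.of_forall fun n => by simpa using hxR n))
    have hx₀opt : x₀ ∈ optSet f M A :=
      hpen _ (fun m n h => by simpa using h) (fun n => (le_max_left _ _).trans (hmax n))
        htend xseq hxmin x₀ hx₀
    obtain ⟨cs, -, U, hU, hlocU⟩ := hloc x₀ hx₀opt
    obtain ⟨n, hnU, hn⟩ :=
      ((hx₀.frequently hU).and_eventually (htend.eventually_ge_atTop cs)).exists
    refine ⟨lam, hkey lam (max c₁ c₂ + n) ((lt_max_of_lt_left hc₁).trans_le (hmax n))
      ⟨x₀, hx₀opt, hx₀opt.1.2, fun y hy => ?_⟩⟩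
    exact (hlocU _ hn _ ⟨hnU, (hxmin n).1⟩).trans ((hxmin n).2 y hy)
end

section
/- Suppose that whenever Ω* ∩ argmin_{x∈A} F(x,λ*,c) ≠ ∅ for some λ* ∈ Λ and c > 0, the function F is globally parametrically exact with exact tuning parameter λ*. Suppose also that A and Ω are closed, f is lower semicontinuous on Ω, and F(·,λ,c) is lower semicontinuous on A for all λ ∈ Λ and c > 0. Then F is globally parametrically exact if and only if there exists λ* ∈ Λ such that: (1) F is of penalty-type for λ = λ*; (2) there exist c₀ > 0, x* ∈ Ω* and a bounded set K ⊆ A such that {x ∈ A : F(x,λ*,c) < F(x*,λ*,c)} ⊆ K for all c ≥ c₀; and (3) F is locally parametrically exact at every globally optimal solution of (P) with exact tuning parameter λ*. -/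
open Set Filter Topology

/-- If the points of a closed set `A` at which a lower semicontinuous function is smaller than at
`a ∈ A` all lie in a bounded set `K`, then the function has a minimizer on `A` lying in the closure
of `insert a K`. -/
theorem exists_mem_minimizersOn_of_sublevel_subset {X : Type*} [PseudoMetricSpace X] [ProperSpace X]
    {g : X → EReal} {A K : Set X} (hA : IsClosed A) (hg : LowerSemicontinuousOn g A)
    (hK : Bornology.IsBounded K) {a : X} (ha : a ∈ A) (hsub : {x ∈ A | g x < g a} ⊆ K) :
    ∃ x ∈ minimizersOn g A, x ∈ closure (insert a K) := by
  have hcomp : IsCompact (closure (insert a K) ∩ A) := (hK.insert a).isCompact_closure.inter_right hA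
  have haC : a ∈ closure (insert a K) ∩ A := ⟨subset_closure (mem_insert a K), ha⟩
  obtain ⟨x, hx, hmin⟩ := (hg.mono inter_subset_right).exists_isMinOn ⟨a, haC⟩ hcomp
  refine ⟨x, ⟨hx.2, fun y hy => ?_⟩, hx.1⟩
  rcases lt_or_ge (g y) (g a) with h | h
  · exact hmin ⟨subset_closure (mem_insert_of_mem a (hsub ⟨hy, h⟩)), hy⟩
  · exact (hmin haC).trans h

/-- Localization Principle in the Parametric Form II. -/
theorem localization_principle_parametric_II
    {X : Type*} [NormedAddCommGroup X] [NormedSpace ℝ X] [FiniteDimensional ℝ X]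
    {Λ : Type*} [Nonempty Λ]
    (f : X → EReal) (M A : Set X) (F : X → Λ → ℝ → EReal)
    (hM : M.Nonempty) (hA : A.Nonempty)
    (hfeas : ∃ x ∈ M ∩ A, f x < ⊤)
    (hopt : (optSet f M A).Nonempty)
    (hkey : ∀ lam : Λ, ∀ c > (0 : ℝ),
      (optSet f M A ∩ minimizersOn (fun x => F x lam c) A).Nonempty →
      GloballyParamExact f M A F lam)
    (hAcl : IsClosed A) (hΩ : IsClosed (M ∩ A))
    (hf : LowerSemicontinuousOn f (M ∩ A))
    (hF : ∀ (lam : Λ) (c : ℝ), 0 < c →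
      LowerSemicontinuousOn (fun x => F x lam c) A) :
    (∃ lam : Λ, GloballyParamExact f M A F lam) ↔
      ∃ lam : Λ,
        PenaltyType f M A F lam ∧
        (∃ c₀ > (0 : ℝ), ∃ xs ∈ optSet f M A, ∃ K : Set X, K ⊆ A ∧
          Bornology.IsBounded K ∧
          ∀ c ≥ c₀, {x ∈ A | F x lam c < F xs lam c} ⊆ K) ∧
        (∀ x₀ ∈ optSet f M A, LocallyParamExact A F lam x₀) := by
  constructor
  · rintro ⟨lam, cs, hcs, hex⟩
    refine ⟨lam, ⟨cs, hcs, fun cseq _ hge _ xseq hx x₀ hx₀ => ?_⟩, ?_, fun x₀ hx₀ => ?_⟩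
    · refine (isClosed_minimizersOn hΩ hf).mem_of_mapClusterPt hx₀ (Eventually.of_forall fun n => ?_)
      have h := hx n
      rwa [hex _ (hge n)] at h
    · obtain ⟨xs, hxs⟩ := hopt
      refine ⟨cs, hcs, xs, hxs, ∅, empty_subset A, Bornology.isBounded_empty, fun c hc x hx => ?_⟩
      rw [← hex c hc] at hxs
      exact absurd (hxs.2 x hx.1) hx.2.not_ge
    · refine ⟨cs, hcs, univ, univ_mem, fun c hc x hx => ?_⟩
      rw [← hex c hc] at hx₀
      exact hx₀.2 x hx.2
  · rintro ⟨lam, ⟨c₁, hc₁, hpen⟩, ⟨c₂, hc₂, xs, hxs, K, -, hK, hsub⟩, hloc⟩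
    refine ⟨lam, ?_⟩
    have : ProperSpace X := FiniteDimensional.proper_real X
    let cseq : ℕ → ℝ := fun n => max c₁ c₂ + n
    have hge (n : ℕ) : max c₁ c₂ ≤ cseq n := le_add_of_nonneg_right n.cast_nonneg
    have hpos (n : ℕ) : 0 < cseq n := (hc₁.trans_le (le_max_left _ _)).trans_le (hge n)
    have hmono : StrictMono cseq := fun m n h => by simpa [cseq] using h
    have htend : Tendsto cseq atTop atTop :=
      tendsto_atTop_add_const_left _ _ tendsto_natCast_atTop_atTop
    choose x hxmin hxmem using fun n => exists_mem_minimizersOn_of_sublevel_subset hAcl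
      (hF lam (cseq n) (hpos n)) hK hxs.1.2 (hsub _ ((le_max_right _ _).trans (hge n)))
    obtain ⟨x₀, -, hx₀⟩ := (hK.insert xs).isCompact_closure.exists_mapClusterPt_of_frequently
      (l := atTop) (Frequently.of_forall hxmem)
    have hx₀opt : x₀ ∈ optSet f M A := hpen cseq hmono
      (fun n => (le_max_left _ _).trans (hge n)) htend x hxmin x₀ hx₀
    obtain ⟨cs, -, U, hU, hle⟩ := hloc x₀ hx₀opt
    obtain ⟨n, hnU, hn⟩ :=
      ((hx₀.frequently hU).and_eventually (htend.eventually_ge_atTop cs)).exists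
    exact hkey lam (cseq n) (hpos n) ⟨x₀, hx₀opt, hx₀opt.1.2, fun y hy =>
      (hle _ hn _ ⟨hnU, (hxmin n).1⟩).trans ((hxmin n).2 y hy)⟩
end
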